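/- Let A be a nontrivial pseudo BL-algebra in which every maximal filter is normal. Then for every n ≥ 1 and all x, y ∈ A: (((x→y)ⁿ)⁻)² ≤ ((x⇝y)^{2n})⁻. -/

import Mathlib

/-- A pseudo BL-algebra: a bounded lattice `(A; ∨, ∧, 0, 1)` together with a monoid
structure `(A; ·, 1)` and two residua `→` (`himp`) and `⇝` (`rimp`) satisfying the
residuation, divisibility and prelinearity conditions. -/
class PseudoBL (A : Type*) extends Lattice A, Monoid A, Zero A where
  himp : A → A → A
  rimp : A → A → A
  zero_le : ∀ x : A, (0 : A) ≤ x
  le_one : ∀ x : A, x ≤ 1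
  mul_le_iff_himp : ∀ x y z : A, x * y ≤ z ↔ x ≤ himp y z
  mul_le_iff_rimp : ∀ x y z : A, x * y ≤ z ↔ y ≤ rimp x z
  himp_mul_inf : ∀ x y : A, himp x y * x = x ⊓ y
  mul_rimp_inf : ∀ x y : A, y * rimp y x = x ⊓ y
  prelin_himp : ∀ x y : A, himp x y ⊔ himp y x = 1
  prelin_rimp : ∀ x y : A, rimp x y ⊔ rimp y x = 1

namespace PseudoBL

variable {A : Type*} [PseudoBL A]

/-- The left negation `x⁻ := x → 0`. -/
def lneg (x : A) : A := himp x 0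

/-- A filter: a nonempty subset closed under `·` and upward closed. -/
def IsFilter (F : Set A) : Prop :=
  F.Nonempty ∧ (∀ x ∈ F, ∀ y ∈ F, x * y ∈ F) ∧ ∀ x ∈ F, ∀ y : A, x ≤ y → y ∈ F

/-- A maximal filter: a proper filter not properly contained in any proper filter. -/
def IsMaximalFilter (F : Set A) : Prop :=
  IsFilter F ∧ F ≠ Set.univ ∧
    ∀ G : Set A, IsFilter G → G ≠ Set.univ → F ⊆ G → F = G

/-- A normal filter: `x→y ∈ F` iff `x⇝y ∈ F`. -/
def IsNormalFilter (F : Set A) : Prop :=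
  ∀ x y : A, himp x y ∈ F ↔ rimp x y ∈ F

end PseudoBL

open PseudoBL


namespace PseudoBLAux

section Abstract

/-- A total, Archimedean, divisible residuated preorder on a monoid is commutative up to `R`. -/
theorem comm_of_arch {A : Type*} [Monoid A] (zero : A) (R : A → A → Prop) (imp : A → A → A)
    (rfl' : ∀ x, R x x) (tr : ∀ {x y z}, R x y → R y z → R x z)
    (tot : ∀ x y, R x y ∨ R y x)
    (mL : ∀ z {x y}, R x y → R (z * x) (z * y))
    (mR : ∀ z {x y}, R x y → R (x * z) (y * z))
    (top : ∀ x, R x 1) (bot : ∀ x, R zero x)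
    (arch : ∀ x, ¬ R 1 x → ∃ k : ℕ, R (x ^ k) zero)
    (res : ∀ x y z, R (x * y) z ↔ R x (imp y z))
    (dvd : ∀ x y, R x y → R x (imp y x * y)) (x y : A) : R (x * y) (y * x) := by
  have mm : ∀ {a b c d}, R a b → R c d → R (a * c) (b * d) :=
    fun {a b c d} h1 h2 => tr (mR c h1) (mL b h2)
  have lt : ∀ {a b}, ¬ R a b → R b a := fun {a b} h => (tot a b).resolve_left h
  by_cases hx0 : R x zero
  · refine tr (mR y hx0) (tr ((res _ _ _).2 (bot _)) (bot _))
  by_cases hy0 : R y zero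
  · refine tr (mL x hy0) (tr (mR zero (top x)) ?_)
    rw [one_mul]; exact bot _
  have approx : ∀ f, ¬ R 1 f → ∀ z, ¬ R z zero → ∃ k : ℕ, R z (f ^ k) ∧ ¬ R z (f ^ (k+1)) := by
    intro f hf z hz
    by_contra hcon
    push Not at hcon
    have : ∀ k : ℕ, R z (f ^ k) := by
      intro k
      induction k with
      | zero => rw [pow_zero]; exact top z
      | succ k ih => exact hcon k ih
    obtain ⟨N, hN⟩ := arch f hf
    exact hz (tr (this N) hN)
  by_contra hne
  by_cases hco : ∃ f, ¬ R 1 f ∧ ∀ g, ¬ R 1 g → R g f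
  · obtain ⟨f, hf, hmax⟩ := hco
    have key : ∀ z, ¬ R z zero → ∃ k : ℕ, R z (f ^ k) ∧ R (f ^ k) z := by
      intro z hz
      obtain ⟨k, h1, h2⟩ := approx f hf z hz
      refine ⟨k, h1, ?_⟩
      by_cases h : R 1 (imp (f ^ k) z)
      · have := (res _ _ _).2 h
        rwa [one_mul] at this
      · exfalso
        apply h2
        rw [pow_succ']
        exact tr (dvd _ _ h1) (mR _ (hmax _ h))
    obtain ⟨k, h1, h2⟩ := key x hx0
    obtain ⟨l, h3, h4⟩ := key y hy0
    apply hne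
    refine tr (mm h1 h3) (tr ?_ (mm h4 h2))
    rw [← pow_add, ← pow_add, add_comm]
    exact rfl' _
  · push Not at hco
    set e := imp (x * y) (y * x) with he
    have he1 : ¬ R 1 e := by
      intro h
      have := (res _ _ _).2 h
      rw [one_mul] at this
      exact hne this
    obtain ⟨g, hg1, hge⟩ := hco e he1
    have hh1 : ¬ R 1 (imp g e) := by
      intro h
      have := (res _ _ _).2 h
      rw [one_mul] at this
      exact hge this
    have hm : ∃ m, ¬ R 1 m ∧ R g m ∧ R (imp g e) m := by
      rcases tot g (imp g e) with h | h
      · exact ⟨_, hh1, h, rfl' _⟩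
      · exact ⟨_, hg1, rfl' _, h⟩
    obtain ⟨m, hm1, hgm, hhm⟩ := hm
    obtain ⟨f, hf1, hfm⟩ := hco m hm1
    have hmf := lt hfm
    have hff : ¬ R (f * f) e := by
      intro h
      have h1 : R (f * g) e := tr (mL f (tr hgm hmf)) h
      exact hfm (tr ((res _ _ _).1 h1) hhm)
    obtain ⟨k, h1, h2⟩ := approx f hf1 x hx0
    obtain ⟨l, h3, h4⟩ := approx f hf1 y hy0
    apply hff
    rw [he, ← res]
    refine tr (mL _ (mm h1 h3)) (tr ?_ (mm (lt h4) (lt h2)))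
    have : f * f * (f ^ k * f ^ l) = f ^ (l + 1) * f ^ (k + 1) := by
      rw [← pow_add, ← pow_add, ← pow_two, ← pow_add]
      congr 1; omega
    rw [this]; exact rfl' _

end Abstract

variable {A : Type*} [PseudoBL A]

theorem mul_mono {a b c d : A} (h1 : a ≤ b) (h2 : c ≤ d) : a * c ≤ b * d := by
  have e1 : a * c ≤ b * c := (mul_le_iff_himp _ _ _).2 (h1.trans ((mul_le_iff_himp _ _ _).1 le_rfl))
  have e2 : b * c ≤ b * d := (mul_le_iff_rimp _ _ _).2 (h2.trans ((mul_le_iff_rimp _ _ _).1 le_rfl))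
  exact e1.trans e2

theorem mul_le_l (a b : A) : a * b ≤ a := by
  simpa using mul_mono (le_refl a) (le_one b)

theorem mul_le_r (a b : A) : a * b ≤ b := by
  simpa using mul_mono (le_one a) (le_refl b)

theorem pow_mono {a b : A} (h : a ≤ b) (n : ℕ) : a ^ n ≤ b ^ n := by
  induction n with
  | zero => simp
  | succ n ih => rw [pow_succ, pow_succ]; exact mul_mono ih h

theorem mp_himp (x y : A) : himp x y * x ≤ y := (mul_le_iff_himp _ _ _).2 le_rfl

theorem mp_rimp (x y : A) : x * rimp x y ≤ y := (mul_le_iff_rimp _ _ _).2 le_rfl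

theorem himp_mul (x y z : A) : himp (x * y) z = himp x (himp y z) := by
  apply le_antisymm
  · rw [← mul_le_iff_himp, ← mul_le_iff_himp, mul_assoc]; exact mp_himp _ _
  · rw [← mul_le_iff_himp, ← mul_assoc, mul_le_iff_himp]; exact mp_himp _ _

theorem sup_mul_le {a b c z : A} (h1 : a * c ≤ z) (h2 : b * c ≤ z) : (a ⊔ b) * c ≤ z :=
  (mul_le_iff_himp _ _ _).2 (sup_le ((mul_le_iff_himp _ _ _).1 h1) ((mul_le_iff_himp _ _ _).1 h2))

theorem mul_sup_le {a b c z : A} (h1 : c * a ≤ z) (h2 : c * b ≤ z) : c * (a ⊔ b) ≤ z :=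
  (mul_le_iff_rimp _ _ _).2 (sup_le ((mul_le_iff_rimp _ _ _).1 h1) ((mul_le_iff_rimp _ _ _).1 h2))

theorem sup_pow_le (a b : A) : ∀ m i j : ℕ, i + j = m → (a ⊔ b) ^ m ≤ a ^ i ⊔ b ^ j := by
  intro m
  induction m with
  | zero =>
    intro i j h
    obtain ⟨rfl, rfl⟩ : i = 0 ∧ j = 0 := by omega
    simp
  | succ m ih =>
    intro i j h
    rcases i with _ | i
    · rw [pow_zero]; exact (le_one _).trans le_sup_left
    rcases j with _ | j
    · rw [pow_zero]; exact (le_one _).trans le_sup_right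
    rw [pow_succ' (a ⊔ b)]
    apply sup_mul_le
    · refine (mul_mono le_rfl (ih i (j+1) (by omega))).trans (mul_sup_le ?_ ?_)
      · rw [← pow_succ']; exact le_sup_left
      · exact (mul_le_r _ _).trans le_sup_right
    · refine (mul_mono le_rfl (ih (i+1) j (by omega))).trans (mul_sup_le ?_ ?_)
      · exact (mul_le_r _ _).trans le_sup_left
      · rw [← pow_succ']; exact le_sup_right

theorem one_mem {F : Set A} (hF : IsFilter F) : (1 : A) ∈ F := by
  obtain ⟨z, hz⟩ := hF.1
  exact hF.2.2 z hz 1 (le_one z)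

theorem pow_mem' {F : Set A} (hF : IsFilter F) {x : A} (hx : x ∈ F) (n : ℕ) : x ^ n ∈ F := by
  induction n with
  | zero => simpa using one_mem hF
  | succ n ih => rw [pow_succ]; exact hF.2.1 _ ih _ hx

/-- Filter generated by `F` and `u`. -/
def gen (F : Set A) (u : A) : Set A := {z | ∃ p ∈ F, ∃ k : ℕ, (p * u) ^ k ≤ z}

theorem gen_filter {F : Set A} (hF : IsFilter F) (u : A) : IsFilter (gen F u) := by
  refine ⟨⟨1, 1, one_mem hF, 0, by simp⟩, ?_, ?_⟩
  · rintro x ⟨p, hp, k, hk⟩ y ⟨q, hq, l, hl⟩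
    refine ⟨p * q, hF.2.1 _ hp _ hq, k + l, ?_⟩
    rw [pow_add]
    exact mul_mono ((pow_mono (mul_mono (mul_le_l _ _) le_rfl) _).trans hk)
      ((pow_mono (mul_mono (mul_le_r _ _) le_rfl) _).trans hl)
  · rintro x ⟨p, hp, k, hk⟩ y hxy
    exact ⟨p, hp, k, hk.trans hxy⟩

theorem subset_gen {F : Set A} (u : A) : F ⊆ gen F u :=
  fun p hp => ⟨p, hp, 1, by rw [pow_one]; exact mul_le_l _ _⟩

theorem mem_gen {F : Set A} (hF : IsFilter F) (u : A) : u ∈ gen F u :=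
  ⟨1, one_mem hF, 1, by simp⟩

theorem exists_max (F : Set A) (hF : IsFilter F) (t : A) (ht : t ∉ F) :
    ∃ P : Set A, F ⊆ P ∧ IsFilter P ∧ t ∉ P ∧ ∀ G, IsFilter G → t ∉ G → P ⊆ G → P = G := by
  obtain ⟨P, hFP, hP⟩ := zorn_subset_nonempty {G : Set A | IsFilter G ∧ t ∉ G} (by
    intro C hC hch hne
    refine ⟨⋃₀ C, ⟨⟨?_, ?_, ?_⟩, ?_⟩, fun s hs => Set.subset_sUnion_of_mem hs⟩
    · obtain ⟨G, hG⟩ := hne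
      exact ⟨1, G, hG, one_mem (hC hG).1⟩
    · rintro x ⟨G, hG, hx⟩ y ⟨H, hH, hy⟩
      rcases hch.total hG hH with h | h
      · exact ⟨H, hH, (hC hH).1.2.1 _ (h hx) _ hy⟩
      · exact ⟨G, hG, (hC hG).1.2.1 _ hx _ (h hy)⟩
    · rintro x ⟨G, hG, hx⟩ y hxy
      exact ⟨G, hG, (hC hG).1.2.2 _ hx _ hxy⟩
    · rintro ⟨G, hG, hx⟩
      exact (hC hG).2 hx) F ⟨hF, ht⟩
  refine ⟨P, hFP, hP.prop.1, hP.prop.2, fun G hG htG hPG => ?_⟩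
  exact Set.Subset.antisymm hPG (hP.le_of_ge ⟨hG, htG⟩ hPG)

theorem mem_gen_of_max {P : Set A} (hP : IsFilter P) {t : A}
    (hmax : ∀ G, IsFilter G → t ∉ G → P ⊆ G → P = G) {u : A} (hu : u ∉ P) : t ∈ gen P u := by
  by_contra h
  have := hmax _ (gen_filter hP u) h (subset_gen u)
  apply hu
  rw [this]
  exact mem_gen hP u

theorem prime_of_max {P : Set A} (hP : IsFilter P) {t : A} (htP : t ∉ P)
    (hmax : ∀ G, IsFilter G → t ∉ G → P ⊆ G → P = G) {u v : A} (huv : u ⊔ v = 1) :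
    u ∈ P ∨ v ∈ P := by
  by_contra hcon
  push Not at hcon
  obtain ⟨p, hp, k, hk⟩ := mem_gen_of_max hP hmax hcon.1
  obtain ⟨q, hq, l, hl⟩ := mem_gen_of_max hP hmax hcon.2
  apply htP
  have hpq := hP.2.1 _ hp _ hq
  refine hP.2.2 _ (pow_mem' hP hpq (k + l)) _ ?_
  have h1 : p * q ≤ (p * q * u) ⊔ (p * q * v) := by
    calc p * q = p * q * (u ⊔ v) := by rw [huv, mul_one]
      _ ≤ _ := mul_sup_le le_sup_left le_sup_right
  refine (pow_mono h1 _).trans ((sup_pow_le _ _ _ k l rfl).trans (sup_le ?_ ?_))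
  · exact (pow_mono (mul_mono (mul_le_l _ _) le_rfl) _).trans hk
  · exact (pow_mono (mul_mono (mul_le_r _ _) le_rfl) _).trans hl

end PseudoBLAux

open PseudoBLAux in
/-- In a nontrivial pseudo BL-algebra where every maximal filter is
normal, `(((x→y)ⁿ)⁻)² ≤ ((x⇝y)^{2n})⁻` for every `n ≥ 1`. -/
theorem stmt_2 {A : Type*} [PseudoBL A] (hnt : (0 : A) ≠ 1)
    (hnorm : ∀ F : Set A, IsMaximalFilter F → IsNormalFilter F)
    (n : ℕ) (hn : 1 ≤ n) (x y : A) :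
    lneg (PseudoBL.himp x y ^ n) ^ 2 ≤ lneg (PseudoBL.rimp x y ^ (2 * n)) := by
  set a := PseudoBL.himp x y with ha
  set b := PseudoBL.rimp x y with hb
  set c := lneg (a ^ n) with hc
  set r := lneg (b ^ (2 * n)) with hr
  by_contra hcon
  have ht1 : PseudoBL.himp (c ^ 2) r ∉ ({1} : Set A) := by
    intro h
    apply hcon
    have h : PseudoBL.himp (c ^ 2) r = 1 := h
    have h2 := mp_himp (c ^ 2) r
    rwa [h, one_mul] at h2
  have hone : IsFilter ({1} : Set A) := by
    refine ⟨⟨1, rfl⟩, ?_, ?_⟩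
    · rintro x rfl y rfl; simp
    · rintro x rfl y h; exact le_antisymm (PseudoBL.le_one y) h
  obtain ⟨P, -, hP, htP, hPmax⟩ := exists_max _ hone _ ht1
  have h0P : (0 : A) ∉ P := fun h => htP (hP.2.2 _ h _ (PseudoBL.zero_le _))
  obtain ⟨M, hPM, hM, h0M, hMmax⟩ := exists_max P hP _ h0P
  have hMM : IsMaximalFilter M := by
    refine ⟨hM, fun h => h0M (h ▸ Set.mem_univ _), fun G hG hGu hMG => hMmax G hG ?_ hMG⟩
    intro h0
    exact hGu (Set.eq_univ_of_forall fun z => hG.2.2 _ h0 _ (PseudoBL.zero_le z))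
  have hN := hnorm M hMM
  have primeP : ∀ u v : A, PseudoBL.himp u v ∈ P ∨ PseudoBL.himp v u ∈ P := fun u v =>
    prime_of_max hP htP hPmax (PseudoBL.prelin_himp u v)
  let R : A → A → Prop := fun u v => PseudoBL.himp u v ∈ M
  have ofle : ∀ {u v : A}, u ≤ v → R u v := fun {u v} h =>
    hM.2.2 _ (one_mem hM) _ ((PseudoBL.mul_le_iff_himp _ _ _).1 (by rwa [one_mul]))
  have tr : ∀ {u v w : A}, R u v → R v w → R u w := fun {u v w} h1 h2 =>
    hM.2.2 _ (hM.2.1 _ h2 _ h1) _ ((PseudoBL.mul_le_iff_himp _ _ _).1 (by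
      rw [mul_assoc]
      exact (mul_mono le_rfl (mp_himp _ _)).trans (mp_himp _ _)))
  have mR : ∀ (w : A) {u v : A}, R u v → R (u * w) (v * w) := fun w {u v} h =>
    hM.2.2 _ h _ ((PseudoBL.mul_le_iff_himp _ _ _).1 (by
      rw [← mul_assoc]; exact mul_mono (mp_himp _ _) le_rfl))
  have mL : ∀ (w : A) {u v : A}, R u v → R (w * u) (w * v) := fun w {u v} h =>
    (hN _ _).2 (hM.2.2 _ ((hN _ _).1 h) _ ((PseudoBL.mul_le_iff_rimp _ _ _).1 (by
      rw [mul_assoc]; exact mul_mono le_rfl (mp_rimp _ _))))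
  have R1 : ∀ {u : A}, R 1 u ↔ u ∈ M := fun {u} => by
    have : PseudoBL.himp 1 u = u := le_antisymm (by simpa using mp_himp 1 u)
      ((PseudoBL.mul_le_iff_himp _ _ _).1 (by rw [mul_one]))
    show PseudoBL.himp 1 u ∈ M ↔ _
    rw [this]
  have res : ∀ u v w : A, R (u * v) w ↔ R u (PseudoBL.himp v w) := fun u v w => by
    show PseudoBL.himp _ _ ∈ M ↔ PseudoBL.himp _ _ ∈ M
    rw [himp_mul]
  have powR : ∀ {u v : A}, R u v → ∀ k : ℕ, R (u ^ k) (v ^ k) := by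
    intro u v h k
    induction k with
    | zero => simpa using ofle (le_refl (1 : A))
    | succ k ih => rw [pow_succ, pow_succ]; exact tr (mR _ ih) (mL _ h)
  have arch : ∀ u : A, ¬ R 1 u → ∃ k : ℕ, R (u ^ k) 0 := by
    intro u hu
    rw [R1] at hu
    obtain ⟨p, hp, k, hk⟩ := mem_gen_of_max hM hMmax hu
    refine ⟨k, tr (powR ?_ k) (ofle hk)⟩
    exact hM.2.2 _ hp _ ((PseudoBL.mul_le_iff_himp _ _ _).1 le_rfl)
  have comm : ∀ u v : A, R (u * v) (v * u) :=
    comm_of_arch (0 : A) R PseudoBL.himp (fun u => ofle le_rfl) tr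
      (fun u v => (primeP u v).imp (fun h => hPM h) (fun h => hPM h)) mL mR
      (fun u => ofle (PseudoBL.le_one u)) (fun u => ofle (PseudoBL.zero_le u)) arch res
      (fun u v h => by
        rw [PseudoBL.himp_mul_inf]
        refine hM.2.2 _ h _ ((PseudoBL.mul_le_iff_himp _ _ _).1 (le_inf (mp_himp _ _) (mul_le_r _ _))))
  have hba : R b a := by
    rw [ha, ← res]
    exact tr (comm b x) (ofle (mp_rimp x y))
  -- a square of something that vanishes mod `M` vanishes mod `P`
  have sq : ∀ d : A, R d 0 → PseudoBL.himp (d * d) 0 ∈ P := by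
    intro d hd
    rw [himp_mul]
    refine (primeP d (PseudoBL.himp d 0)).resolve_right fun h => ?_
    have h2 : d ∈ M := hM.2.2 _ (hM.2.1 _ (hPM h) _ hd) _ (mp_himp _ _)
    exact h0M (hM.2.2 _ (hM.2.1 _ hd _ h2) _ (mp_himp _ _))
  have hrs : R r (c ^ 2) := hPM ((primeP (c ^ 2) r).resolve_left htP)
  have hcr : R c r := by
    rw [hr, lneg, ← res]
    refine tr (mL c (powR hba (2 * n))) (ofle ?_)
    rw [two_mul, pow_add]
    exact (mul_mono le_rfl (mul_le_l _ _)).trans (mp_himp _ _)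
  have hcc : R c (c * c) := by
    rw [← pow_two]; exact tr hcr hrs
  by_cases hcM : c ∈ M
  · have h1 : R (a ^ n) 0 := hcM
    have h2 := sq _ (tr (powR hba n) h1)
    rw [← pow_add, ← two_mul] at h2
    exact htP (hP.2.2 _ h2 _ ((PseudoBL.mul_le_iff_himp _ _ _).1 (mul_le_l _ _)))
  · obtain ⟨k, hk⟩ := arch c (fun h => hcM (R1.1 h))
    have hck : ∀ k : ℕ, R c (c ^ k) := by
      intro k
      induction k with
      | zero => rw [pow_zero]; exact ofle (PseudoBL.le_one _)
      | succ k ih => rw [pow_succ]; exact tr hcc (mR _ ih)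
    have h2 := sq c (tr (hck k) hk)
    rw [← pow_two] at h2
    exact htP (hP.2.2 _ h2 _ ((PseudoBL.mul_le_iff_himp _ _ _).1
      ((mp_himp _ _).trans (PseudoBL.zero_le _))))
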